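/- arXiv:2102.04546 — 2 statements merged into one kernel-verified Lean document; each statement's English description precedes it below -/
import Mathlib

section
/- There exists an absolute constant C > 0 such that the following holds. Let U be a finite set of size k ≥ 1, let 0 < α < 1, 0 < δ < 1, 0 < ν < 1, and set s = ⌈3·ln(4/ν)/(α²·δ)⌉. If s ≤ k, then there exist an integer t with 1 ≤ t ≤ C·(k/ν + k·ln(2k)) and a family S_1, …, S_t of subsets of U, each of cardinality exactly s, which is an (α,δ,ν)-representative family, i.e.: (i) for every T ⊆ U with |T| ≥ δk, at least (1−ν)·t indices i ∈ [t] satisfy |S_i ∩ T|/s ∈ [(1−α)·|T|/k, (1+α)·|T|/k]; (ii) for every T ⊆ U with |T| < δk, at least (1−ν)·t indices i ∈ [t] satisfy |S_i ∩ T|/s ≤ (1+α)·δ; and (iii) for every u ∈ U, the number of indices i ∈ [t] with u ∈ S_i lies in [(1−α)·s·t/k, (1+α)·s·t/k]. -/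
open Finset

/-- The set size `s = ⌈3·ln(4/ν)/(α²·δ)⌉` used for representative families. -/
noncomputable def repSetSize (α δ ν : ℝ) : ℕ :=
  ⌈3 * Real.log (4 / ν) / (α ^ 2 * δ)⌉₊

/-- Upper Chernoff tail from a Poisson-type bound on the exponential moments. -/
theorem card_upper_tail_le {ι : Type*} (Ω : Finset ι) (X : ι → ℝ) {μ q α : ℝ}
    (hα : 0 < α) (hα1 : α ≤ 1) (hq : 0 ≤ q) (hμq : μ ≤ q)
    (hX : ∀ l : ℝ, ∑ ω ∈ Ω, Real.exp (l * X ω) ≤ #Ω * Real.exp ((Real.exp l - 1) * μ)) :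
    (#{ω ∈ Ω | (1 + α) * q ≤ X ω} : ℝ) ≤ #Ω * Real.exp (-(α ^ 2 * q / 3)) := by
  set l := Real.log (1 + α) with hl
  have hexp : Real.exp l = 1 + α := Real.exp_log (by linarith)
  have hl0 : 0 ≤ l := Real.log_nonneg (by linarith)
  have h1 : (#{ω ∈ Ω | (1 + α) * q ≤ X ω} : ℝ) * Real.exp (l * ((1 + α) * q))
      ≤ #Ω * Real.exp (α * q) := by
    calc (#{ω ∈ Ω | (1 + α) * q ≤ X ω} : ℝ) * Real.exp (l * ((1 + α) * q))
        = ∑ ω ∈ Ω with (1 + α) * q ≤ X ω, Real.exp (l * ((1 + α) * q)) := by simp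
      _ ≤ ∑ ω ∈ Ω with (1 + α) * q ≤ X ω, Real.exp (l * X ω) := by
          refine sum_le_sum fun ω hω => ?_
          rw [mem_filter] at hω
          exact Real.exp_le_exp.2 (mul_le_mul_of_nonneg_left hω.2 hl0)
      _ ≤ ∑ ω ∈ Ω, Real.exp (l * X ω) :=
          sum_le_sum_of_subset_of_nonneg (filter_subset _ _) fun _ _ _ => (Real.exp_pos _).le
      _ ≤ #Ω * Real.exp ((Real.exp l - 1) * μ) := hX l
      _ ≤ #Ω * Real.exp (α * q) := by
          rw [hexp, add_sub_cancel_left]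
          gcongr
  have h2 : α * q - l * ((1 + α) * q) ≤ -(α ^ 2 * q / 3) := by
    have h3 : α + α ^ 2 / 3 ≤ l * (1 + α) := by
      have h4 := Real.le_log_one_add_of_nonneg hα.le
      have h5 : α + α ^ 2 / 3 ≤ 2 * α / (α + 2) * (1 + α) := by
        rw [div_mul_eq_mul_div, le_div_iff₀ (by linarith)]
        nlinarith [sq_nonneg α, mul_nonneg (sq_nonneg α) (sub_nonneg.2 hα1)]
      exact h5.trans (mul_le_mul_of_nonneg_right h4 (by linarith))
    nlinarith
  calc _ ≤ #Ω * Real.exp (α * q) / Real.exp (l * ((1 + α) * q)) :=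
        (le_div_iff₀ (Real.exp_pos _)).2 h1
    _ = #Ω * Real.exp (α * q - l * ((1 + α) * q)) := by rw [Real.exp_sub, mul_div_assoc]
    _ ≤ _ := by gcongr

theorem exp_neg_le_quadratic {x : ℝ} (hx : 0 ≤ x) : Real.exp (-x) ≤ 1 - x + x ^ 2 / 2 := by
  rw [Real.exp_neg, inv_le_iff_one_le_mul₀ (Real.exp_pos x)]
  have h := Real.quadratic_le_exp_of_nonneg hx
  have h0 : 0 ≤ 1 - x + x ^ 2 / 2 := by nlinarith [sq_nonneg (x - 1)]
  nlinarith [mul_le_mul_of_nonneg_left h h0, sq_nonneg (x ^ 2)]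

/-- Lower Chernoff tail from a Poisson-type bound on the exponential moments. -/
theorem card_lower_tail_le {ι : Type*} (Ω : Finset ι) (X : ι → ℝ) {μ α : ℝ}
    (hα : 0 < α) (hμ : 0 ≤ μ)
    (hX : ∀ l : ℝ, ∑ ω ∈ Ω, Real.exp (l * X ω) ≤ #Ω * Real.exp ((Real.exp l - 1) * μ)) :
    (#{ω ∈ Ω | X ω ≤ (1 - α) * μ} : ℝ) ≤ #Ω * Real.exp (-(α ^ 2 * μ / 3)) := by
  have h1 : (#{ω ∈ Ω | X ω ≤ (1 - α) * μ} : ℝ) * Real.exp (-α * ((1 - α) * μ))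
      ≤ #Ω * Real.exp ((Real.exp (-α) - 1) * μ) := by
    calc (#{ω ∈ Ω | X ω ≤ (1 - α) * μ} : ℝ) * Real.exp (-α * ((1 - α) * μ))
        = ∑ ω ∈ Ω with X ω ≤ (1 - α) * μ, Real.exp (-α * ((1 - α) * μ)) := by simp
      _ ≤ ∑ ω ∈ Ω with X ω ≤ (1 - α) * μ, Real.exp (-α * X ω) := by
          refine sum_le_sum fun ω hω => ?_
          rw [mem_filter] at hω
          exact Real.exp_le_exp.2 (mul_le_mul_of_nonpos_left hω.2 (by linarith))
      _ ≤ ∑ ω ∈ Ω, Real.exp (-α * X ω) :=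
          sum_le_sum_of_subset_of_nonneg (filter_subset _ _) fun _ _ _ => (Real.exp_pos _).le
      _ ≤ _ := hX (-α)
  have h2 : (Real.exp (-α) - 1) * μ - -α * ((1 - α) * μ) ≤ -(α ^ 2 * μ / 3) := by
    nlinarith [mul_le_mul_of_nonneg_right (exp_neg_le_quadratic hα.le) hμ,
      mul_nonneg (sq_nonneg α) hμ]
  calc _ ≤ #Ω * Real.exp ((Real.exp (-α) - 1) * μ) / Real.exp (-α * ((1 - α) * μ)) :=
        (le_div_iff₀ (Real.exp_pos _)).2 h1
    _ = #Ω * Real.exp ((Real.exp (-α) - 1) * μ - -α * ((1 - α) * μ)) := by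
        rw [Real.exp_sub, mul_div_assoc]
    _ ≤ _ := by gcongr

/-- Exponential moments of a binomial count: a uniformly random sequence in `Ω`, counting the
entries that satisfy `P`. -/
theorem sum_exp_count_le {ι : Type*} (Ω : Finset ι) (hΩ : Ω.Nonempty) (P : ι → Prop)
    [DecidablePred P] (t : ℕ) (l : ℝ) :
    ∑ f ∈ Fintype.piFinset (fun _ : Fin t => Ω), Real.exp (l * #{i | P (f i)})
      ≤ #(Fintype.piFinset (fun _ : Fin t => Ω)) *
        Real.exp ((Real.exp l - 1) * (#{ω ∈ Ω | P ω} / #Ω * t)) := by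
  have hΩ0 : (0 : ℝ) < #Ω := by exact_mod_cast hΩ.card_pos
  have h1 : ∀ f : Fin t → ι, Real.exp (l * #{i | P (f i)})
      = ∏ i, (if P (f i) then Real.exp l else 1) := by
    intro f
    rw [prod_ite, prod_const, prod_const_one, mul_one, ← Real.exp_nat_mul, mul_comm]
  have h2 : ∑ ω ∈ Ω, (if P ω then Real.exp l else 1)
      = #Ω * (1 + (Real.exp l - 1) * (#{ω ∈ Ω | P ω} / #Ω)) := by
    have h3 : ∀ ω, (if P ω then Real.exp l else 1)
        = 1 + (Real.exp l - 1) * (if P ω then 1 else 0) := by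
      intro ω; split_ifs <;> ring
    simp_rw [h3, sum_add_distrib, ← mul_sum, sum_boole]
    simp only [sum_const, nsmul_eq_mul, mul_one]
    field_simp
  simp_rw [h1]
  rw [← prod_univ_sum (fun _ : Fin t => Ω) (fun _ ω => if P ω then Real.exp l else 1)]
  rw [prod_const, h2, Fintype.card_piFinset_const, mul_pow, card_univ, Fintype.card_fin]
  push_cast
  refine mul_le_mul_of_nonneg_left ?_ (by positivity)
  have h4 : 0 ≤ 1 + (Real.exp l - 1) * (#{ω ∈ Ω | P ω} / #Ω : ℝ) := by
    have h5 : 0 ≤ ∑ ω ∈ Ω, (if P ω then Real.exp l else 1) :=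
      sum_nonneg fun ω _ => by split_ifs <;> positivity
    rw [h2] at h5
    exact nonneg_of_mul_nonneg_right h5 hΩ0
  calc _ ≤ Real.exp ((Real.exp l - 1) * (#{ω ∈ Ω | P ω} / #Ω)) ^ t := by
        refine pow_le_pow_left₀ h4 ?_ t
        rw [add_comm]; exact Real.add_one_le_exp _
    _ = _ := by rw [← Real.exp_nat_mul]; congr 1; ring

theorem descFactorial_mul_pow_le {m k : ℕ} (h : m ≤ k) (j : ℕ) :
    m.descFactorial j * k ^ j ≤ m ^ j * k.descFactorial j := by
  induction j with
  | zero => simp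
  | succ j ih =>
    rw [Nat.descFactorial_succ, Nat.descFactorial_succ, pow_succ, pow_succ]
    have : (m - j) * k ≤ m * (k - j) := by
      rw [Nat.sub_mul, Nat.mul_sub]
      have := Nat.mul_le_mul_left j h
      rw [mul_comm j m] at this
      omega
    calc (m - j) * m.descFactorial j * (k ^ j * k)
        = ((m - j) * k) * (m.descFactorial j * k ^ j) := by ring
      _ ≤ (m * (k - j)) * (m ^ j * k.descFactorial j) := Nat.mul_le_mul this ih
      _ = _ := by ring

theorem choose_mul_pow_le {m k : ℕ} (h : m ≤ k) (j : ℕ) :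
    m.choose j * k ^ j ≤ m ^ j * k.choose j := by
  have := descFactorial_mul_pow_le h j
  rw [Nat.descFactorial_eq_factorial_mul_choose, Nat.descFactorial_eq_factorial_mul_choose] at this
  refine Nat.le_of_mul_le_mul_left ?_ j.factorial_pos
  linarith

/-- Hypergeometric moments at a point `1 + x ≥ 1`. -/
theorem sum_one_add_pow_card_inter_le {U : Type*} [Fintype U] [DecidableEq U]
    (T : Finset U) (s : ℕ) (hU : 0 < Fintype.card U)
    {x : ℝ} (hx : 0 ≤ x) :
    ∑ S ∈ powersetCard s (univ : Finset U), (1 + x) ^ #(S ∩ T)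
      ≤ (Fintype.card U).choose s * (1 + x * (#T / Fintype.card U)) ^ s := by
  have hk : (0 : ℝ) < Fintype.card U := by exact_mod_cast hU
  have hT : #T ≤ Fintype.card U := card_le_univ T
  have h1 : ∀ S ∈ powersetCard s (univ : Finset U), (1 + x) ^ #(S ∩ T)
      = ∑ j ∈ range (s + 1), ∑ A ∈ powersetCard j T, if A ⊆ S then x ^ j else 0 := by
    intro S hS
    rw [mem_powersetCard_univ] at hS
    have hle : #(S ∩ T) ≤ s := hS ▸ card_le_card inter_subset_left
    have h2 : ∀ j, ∑ A ∈ powersetCard j T, (if A ⊆ S then x ^ j else 0)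
        = x ^ j * (#(S ∩ T)).choose j := by
      intro j
      rw [← sum_filter, sum_const, nsmul_eq_mul, mul_comm, ← card_powersetCard]
      congr 3
      ext A
      simp only [mem_filter, mem_powersetCard, subset_inter_iff]
      tauto
    simp_rw [h2]
    rw [add_comm, add_pow]
    simp only [one_pow, mul_one]
    refine sum_subset (range_subset_range.2 (by omega)) fun j _ hj => ?_
    rw [mem_range, not_lt] at hj
    rw [Nat.choose_eq_zero_of_lt (by omega)]
    simp
  rw [sum_congr rfl h1, sum_comm, add_comm 1 (x * _), add_pow, mul_sum]
  refine sum_le_sum fun j hj => ?_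
  have hjs : j ≤ s := by rw [mem_range] at hj; omega
  rw [sum_comm]
  have h3 : ∀ A ∈ powersetCard j T,
      ∑ S ∈ powersetCard s (univ : Finset U), (if A ⊆ S then x ^ j else 0)
        = ((Fintype.card U - j).choose (s - j) : ℝ) * x ^ j := by
    intro A hA
    rw [mem_powersetCard] at hA
    rw [← sum_filter, sum_const, nsmul_eq_mul,
      card_filter_powersetCard_subset A univ s (subset_univ A) (hA.2.le.trans hjs), hA.2,
      card_univ]
  rw [sum_congr rfl h3, sum_const, card_powersetCard, nsmul_eq_mul]
  simp only [one_pow, mul_one]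
  have h4 : ((Fintype.card U).choose s : ℝ) * s.choose j
      = (Fintype.card U).choose j * (Fintype.card U - j).choose (s - j) := by
    exact_mod_cast Nat.choose_mul hjs
  have h5 : ((#T).choose j : ℝ) ≤ (#T / Fintype.card U) ^ j * (Fintype.card U).choose j := by
    rw [div_pow, div_mul_eq_mul_div, le_div_iff₀ (by positivity)]
    exact_mod_cast choose_mul_pow_le hT j
  calc ((#T).choose j : ℝ) * ((Fintype.card U - j).choose (s - j) * x ^ j)
      ≤ ((#T / Fintype.card U) ^ j * (Fintype.card U).choose j)
        * ((Fintype.card U - j).choose (s - j) * x ^ j) := by gcongr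
    _ = (#T / Fintype.card U) ^ j * x ^ j *
        ((Fintype.card U).choose j * (Fintype.card U - j).choose (s - j)) := by ring
    _ = _ := by rw [← h4, mul_pow]; ring

/-- Exponential moments of a hypergeometric variable. -/
theorem sum_exp_card_inter_le {U : Type*} [Fintype U] [DecidableEq U]
    (T : Finset U) (s : ℕ) (hU : 0 < Fintype.card U) (l : ℝ) :
    ∑ S ∈ powersetCard s (univ : Finset U), Real.exp (l * #(S ∩ T))
      ≤ #(powersetCard s (univ : Finset U)) *
        Real.exp ((Real.exp l - 1) * (#T / Fintype.card U * s)) := by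
  have hk : (0 : ℝ) < Fintype.card U := by exact_mod_cast hU
  have hT : (#T : ℝ) ≤ Fintype.card U := by exact_mod_cast card_le_univ T
  have hp1 : (#T / Fintype.card U : ℝ) ≤ 1 := (div_le_one hk).2 hT
  have hp0 : 0 ≤ (#T / Fintype.card U : ℝ) := by positivity
  have key : ∑ S ∈ powersetCard s (univ : Finset U), Real.exp (l * #(S ∩ T))
      ≤ (Fintype.card U).choose s * (1 + (Real.exp l - 1) * (#T / Fintype.card U)) ^ s := by
    rcases le_total 0 l with hl | hl
    · have h := sum_one_add_pow_card_inter_le T s hU (sub_nonneg.2 (Real.one_le_exp hl))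
      refine le_trans (le_of_eq ?_) h
      refine sum_congr rfl fun S _ => ?_
      rw [add_sub_cancel, ← Real.exp_nat_mul, mul_comm]
    · have h := sum_one_add_pow_card_inter_le Tᶜ s hU
        (sub_nonneg.2 (Real.one_le_exp (neg_nonneg.2 hl)))
      have h1 : ∀ S ∈ powersetCard s (univ : Finset U), Real.exp (l * #(S ∩ T))
          = Real.exp l ^ s * (1 + (Real.exp (-l) - 1)) ^ #(S ∩ Tᶜ) := by
        intro S hS
        rw [mem_powersetCard_univ] at hS
        have h2 : (#(S ∩ T) : ℝ) + #(S ∩ Tᶜ) = s := by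
          rw [← sdiff_eq_inter_compl]
          exact_mod_cast hS ▸ card_inter_add_card_sdiff S T
        rw [add_sub_cancel, ← Real.exp_nat_mul, ← Real.exp_nat_mul, ← Real.exp_add, ← h2]
        congr 1; ring
      rw [sum_congr rfl h1, ← mul_sum]
      refine (mul_le_mul_of_nonneg_left h (by positivity)).trans (le_of_eq ?_)
      rw [mul_left_comm, ← mul_pow]
      congr 2
      have h3 : (#Tᶜ : ℝ) = Fintype.card U - #T := by
        rw [card_compl, Nat.cast_sub (card_le_univ T)]
      have h4 : Real.exp l * Real.exp (-l) = 1 := by rw [← Real.exp_add]; simp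
      rw [h3, sub_div, div_self hk.ne']
      linear_combination (1 - #T / Fintype.card U : ℝ) * h4
  refine key.trans ?_
  rw [card_powersetCard, card_univ]
  refine mul_le_mul_of_nonneg_left ?_ (by positivity)
  have h4 : 0 ≤ 1 + (Real.exp l - 1) * (#T / Fintype.card U : ℝ) := by
    nlinarith [mul_nonneg (Real.exp_pos l).le hp0]
  calc _ ≤ Real.exp ((Real.exp l - 1) * (#T / Fintype.card U)) ^ s := by
        refine pow_le_pow_left₀ h4 ?_ s
        rw [add_comm]; exact Real.add_one_le_exp _
    _ = _ := by rw [← Real.exp_nat_mul]; congr 1; ring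

/-- A point belongs to the expected fraction of the `s`-subsets. -/
theorem card_filter_mem_powersetCard_univ_div {U : Type*} [Fintype U] [DecidableEq U] (u : U)
    {s : ℕ} (hs0 : 0 < s) (hs : s ≤ Fintype.card U) :
    (#{S ∈ powersetCard s (univ : Finset U) | u ∈ S} : ℝ) / #(powersetCard s (univ : Finset U))
      = s / Fintype.card U := by
  have h := card_filter_powersetCard_subset {u} univ s (subset_univ _)
    (by rw [card_singleton]; exact hs0)
  simp only [singleton_subset_iff, card_singleton, card_univ] at h
  have hc : 0 < (Fintype.card U).choose s := Nat.choose_pos hs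
  rw [h, card_powersetCard, card_univ, div_eq_div_iff (by positivity)
    (by norm_cast; omega)]
  obtain ⟨s, rfl⟩ := Nat.exists_eq_succ_of_ne_zero hs0.ne'
  obtain ⟨k, hk⟩ := Nat.exists_eq_succ_of_ne_zero (by omega : Fintype.card U ≠ 0)
  rw [hk]
  have := Nat.add_one_mul_choose_eq k s
  simp only [Nat.succ_eq_add_one, Nat.add_sub_cancel]
  norm_cast
  linarith

/-- The intersection pattern required of a sample `S` of size `s` against a test set `T`. -/
def IsRepresentativeFor {U : Type*} [Fintype U] [DecidableEq U] (α δ : ℝ) (s : ℕ)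
    (T S : Finset U) : Prop :=
  (δ * Fintype.card U ≤ (#T : ℝ) → (#(S ∩ T) : ℝ) / s ∈
    Set.Icc ((1 - α) * #T / Fintype.card U) ((1 + α) * #T / Fintype.card U)) ∧
  ((#T : ℝ) < δ * Fintype.card U → (#(S ∩ T) : ℝ) / s ≤ (1 + α) * δ)

open scoped Classical in
theorem card_filter_not_isRepresentativeFor_le {U : Type*} [Fintype U] [DecidableEq U]
    {α δ ν : ℝ} (hα : 0 < α) (hα1 : α < 1) (hδ : 0 < δ) (hν : 0 < ν) {s : ℕ} (hs : 0 < s)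
    (hU : 0 < Fintype.card U) (hlog : Real.log (4 / ν) ≤ α ^ 2 * (δ * s) / 3) (T : Finset U) :
    (#{S ∈ powersetCard s (univ : Finset U) | ¬ IsRepresentativeFor α δ s T S} : ℝ)
      ≤ #(powersetCard s (univ : Finset U)) * (ν / 2) := by
  set Ω := powersetCard s (univ : Finset U)
  have hk : (0 : ℝ) < Fintype.card U := by exact_mod_cast hU
  have hs' : (0 : ℝ) < s := by exact_mod_cast hs
  have hX := sum_exp_card_inter_le T s hU
  set p : ℝ := #T / Fintype.card U with hp
  have hexp : ∀ q : ℝ, δ * s ≤ q → Real.exp (-(α ^ 2 * q / 3)) ≤ ν / 4 := by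
    intro q hq
    have h : Real.exp (-Real.log (4 / ν)) = ν / 4 := by
      rw [Real.exp_neg, Real.exp_log (by positivity), inv_div]
    rw [← h]
    apply Real.exp_le_exp.2
    have := mul_le_mul_of_nonneg_left hq (sq_nonneg α)
    linarith
  by_cases hT : δ * Fintype.card U ≤ (#T : ℝ)
  · have hpδ : δ ≤ p := (le_div_iff₀ hk).2 hT
    have hq : δ * s ≤ p * s := mul_le_mul_of_nonneg_right hpδ hs'.le
    have hq0 : 0 ≤ p * s := le_trans (by positivity) hq
    have h1 := card_upper_tail_le Ω (fun S => (#(S ∩ T) : ℝ)) hα hα1.le hq0 le_rfl hX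
    have h2 := card_lower_tail_le Ω (fun S => (#(S ∩ T) : ℝ)) hα hq0 hX
    have h3 : {S ∈ Ω | ¬ IsRepresentativeFor α δ s T S}
        ⊆ {S ∈ Ω | (1 + α) * (p * s) ≤ #(S ∩ T)} ∪ {S ∈ Ω | (#(S ∩ T) : ℝ) ≤ (1 - α) * (p * s)} := by
      intro S hS
      simp only [mem_filter, mem_union] at hS ⊢
      by_contra! hcon
      refine hS.2 ⟨fun _ => ⟨?_, ?_⟩, fun h => absurd hT (not_le.2 h)⟩
      · rw [le_div_iff₀ hs', mul_div_assoc, mul_assoc]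
        exact (hcon.2 hS.1).le
      · rw [div_le_iff₀ hs', mul_div_assoc, mul_assoc]
        exact (hcon.1 hS.1).le
    have h4 : (#{S ∈ Ω | ¬ IsRepresentativeFor α δ s T S} : ℝ) ≤
        #{S ∈ Ω | (1 + α) * (p * s) ≤ #(S ∩ T)} + #{S ∈ Ω | (#(S ∩ T) : ℝ) ≤ (1 - α) * (p * s)} := by
      exact_mod_cast (card_le_card h3).trans (card_union_le _ _)
    have h5 := mul_le_mul_of_nonneg_left (hexp _ hq) (Nat.cast_nonneg (α := ℝ) #Ω)
    linarith
  · rw [not_le] at hT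
    have hpδ : p ≤ δ := (div_le_iff₀ hk).2 hT.le
    have h1 := card_upper_tail_le Ω (fun S => (#(S ∩ T) : ℝ)) hα hα1.le
      (by positivity : 0 ≤ δ * s) (mul_le_mul_of_nonneg_right hpδ hs'.le) hX
    have h3 : {S ∈ Ω | ¬ IsRepresentativeFor α δ s T S}
        ⊆ {S ∈ Ω | (1 + α) * (δ * s) ≤ #(S ∩ T)} := by
      intro S hS
      simp only [mem_filter] at hS ⊢
      refine ⟨hS.1, ?_⟩
      by_contra! hcon
      refine hS.2 ⟨fun h => absurd h (not_le.2 hT), fun _ => ?_⟩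
      rw [div_le_iff₀ hs', mul_assoc]
      exact hcon.le
    have h4 : (#{S ∈ Ω | ¬ IsRepresentativeFor α δ s T S} : ℝ) ≤
        #{S ∈ Ω | (1 + α) * (δ * s) ≤ #(S ∩ T)} := by
      exact_mod_cast card_le_card h3
    have h5 := mul_le_mul_of_nonneg_left (hexp _ le_rfl) (Nat.cast_nonneg (α := ℝ) #Ω)
    have h6 : 0 ≤ (#Ω : ℝ) * (ν / 4) := by positivity
    linarith

open scoped Classical in
/-- A sequence of length `t` in `Ω` hitting, for every `a`, the rare event `B a` at most `ν * t`
times, and, for every `u`, the event `D u` of probability `p` close to the expected number of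
times. -/
theorem exists_balanced_sequence {ι κ τ : Type*} [Fintype κ] [Fintype τ] (Ω : Finset ι)
    (hΩ : Ω.Nonempty) (B : κ → ι → Prop) (D : τ → ι → Prop) {α ν p : ℝ} {t : ℕ}
    (hα : 0 < α) (hα1 : α ≤ 1) (hν : 0 < ν) (hp : 0 ≤ p)
    (hB : ∀ a, (#{ω ∈ Ω | B a ω} : ℝ) ≤ #Ω * (ν / 2))
    (hD : ∀ u, (#{ω ∈ Ω | D u ω} : ℝ) / #Ω = p)
    (hlt : Fintype.card κ * Real.exp (-(ν * t / 6)) +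
      Fintype.card τ * (2 * Real.exp (-(α ^ 2 * (p * t) / 3))) < 1) :
    ∃ f : Fin t → ι, (∀ i, f i ∈ Ω) ∧ (∀ a, (#{i | B a (f i)} : ℝ) ≤ ν * t) ∧
      ∀ u, (#{i | D u (f i)} : ℝ) ∈ Set.Icc ((1 - α) * (p * t)) ((1 + α) * (p * t)) := by
  set F := Fintype.piFinset (fun _ : Fin t => Ω) with hF
  have hΩ0 : (0 : ℝ) < #Ω := by exact_mod_cast hΩ.card_pos
  have hF0 : (0 : ℝ) < #F := by
    rw [hF, Fintype.card_piFinset_const]; positivity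
  set E₁ : κ → Finset (Fin t → ι) := fun a => {f ∈ F | (1 + 1) * (ν / 2 * t) ≤ #{i | B a (f i)}}
  set E₂ : τ → Finset (Fin t → ι) := fun u => {f ∈ F | (1 + α) * (p * t) ≤ #{i | D u (f i)}}
  set E₃ : τ → Finset (Fin t → ι) :=
    fun u => {f ∈ F | (#{i | D u (f i)} : ℝ) ≤ (1 - α) * (p * t)}
  have h1 : ∀ a, (#(E₁ a) : ℝ) ≤ #F * Real.exp (-(ν * t / 6)) := by
    intro a
    have h := card_upper_tail_le F (fun f => (#{i | B a (f i)} : ℝ)) one_pos le_rfl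
      (by positivity : 0 ≤ ν / 2 * t) (mul_le_mul_of_nonneg_right
        ((div_le_iff₀' hΩ0).2 (hB a)) (Nat.cast_nonneg t)) (sum_exp_count_le Ω hΩ (B a) t)
    refine h.trans (le_of_eq ?_)
    congr 3; ring
  have hDX : ∀ u, ∀ l : ℝ, ∑ f ∈ F, Real.exp (l * #{i | D u (f i)})
      ≤ #F * Real.exp ((Real.exp l - 1) * (p * t)) := by
    intro u l
    rw [← hD u]
    exact sum_exp_count_le Ω hΩ (D u) t l
  have h2 : ∀ u, (#(E₂ u) : ℝ) ≤ #F * Real.exp (-(α ^ 2 * (p * t) / 3)) := fun u =>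
    card_upper_tail_le F (fun f => (#{i | D u (f i)} : ℝ)) hα hα1 (by positivity) le_rfl (hDX u)
  have h3 : ∀ u, (#(E₃ u) : ℝ) ≤ #F * Real.exp (-(α ^ 2 * (p * t) / 3)) := fun u =>
    card_lower_tail_le F (fun f => (#{i | D u (f i)} : ℝ)) hα (by positivity) (hDX u)
  have hlt' : #((univ.biUnion E₁) ∪ (univ.biUnion fun u => E₂ u ∪ E₃ u)) < #F := by
    have hκ : (#(univ.biUnion E₁) : ℝ) ≤ Fintype.card κ * (#F * Real.exp (-(ν * t / 6))) := by
      calc (#(univ.biUnion E₁) : ℝ) ≤ ∑ a, (#(E₁ a) : ℝ) := by exact_mod_cast card_biUnion_le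
        _ ≤ ∑ _a : κ, #F * Real.exp (-(ν * t / 6)) := sum_le_sum fun a _ => h1 a
        _ = _ := by simp
    have hτ : (#(univ.biUnion fun u => E₂ u ∪ E₃ u) : ℝ)
        ≤ Fintype.card τ * (2 * (#F * Real.exp (-(α ^ 2 * (p * t) / 3)))) := by
      calc (#(univ.biUnion fun u => E₂ u ∪ E₃ u) : ℝ) ≤ ∑ u, (#(E₂ u ∪ E₃ u) : ℝ) := by
            exact_mod_cast card_biUnion_le
        _ ≤ ∑ _u : τ, 2 * (#F * Real.exp (-(α ^ 2 * (p * t) / 3))) := by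
            refine sum_le_sum fun u _ => ?_
            have : (#(E₂ u ∪ E₃ u) : ℝ) ≤ #(E₂ u) + #(E₃ u) := by
              exact_mod_cast card_union_le _ _
            linarith [h2 u, h3 u]
        _ = _ := by simp
    have hu : (#((univ.biUnion E₁) ∪ (univ.biUnion fun u => E₂ u ∪ E₃ u)) : ℝ)
        ≤ #(univ.biUnion E₁) + #(univ.biUnion fun u => E₂ u ∪ E₃ u) := by
      exact_mod_cast card_union_le _ _
    have := mul_lt_mul_of_pos_left hlt hF0
    have hR : (#((univ.biUnion E₁) ∪ (univ.biUnion fun u => E₂ u ∪ E₃ u)) : ℝ) < #F := by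
      linarith
    exact_mod_cast hR
  obtain ⟨f, hfF, hf⟩ := exists_mem_notMem_of_card_lt_card hlt'
  simp only [mem_union, mem_biUnion, mem_univ, true_and, not_or, not_exists, E₁, E₂, E₃,
    mem_filter, hfF, not_le] at hf
  refine ⟨f, fun i => Fintype.mem_piFinset.1 hfF i, fun a => ?_, fun u => ⟨?_, ?_⟩⟩
  · linarith [hf.1 a]
  · exact (hf.2 u).2.le
  · exact (hf.2 u).1.le

theorem two_pow_mul_exp_add_lt_one {k t : ℕ} (hk : 1 ≤ k) {ν β : ℝ} (hν : 0 < ν)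
    (hν1 : ν < 1) (hβ : 1 ≤ β) (ht : 12 * ((k : ℝ) / ν + k * Real.log (2 * k)) ≤ t) :
    (2 : ℝ) ^ k * Real.exp (-(ν * t / 6)) + k * (2 * Real.exp (-(β * (t / k)))) < 1 := by
  have hk' : (1 : ℝ) ≤ k := by exact_mod_cast hk
  have hk0 : (0 : ℝ) < k := by linarith
  have hlog : 0 ≤ Real.log (2 * k) := Real.log_nonneg (by linarith)
  have he : Real.exp (-1) < 1 / 2 := by
    rw [Real.exp_neg, one_div]
    exact inv_strictAnti₀ two_pos (by linarith [Real.exp_one_gt_d9])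
  have h1 : (2 : ℝ) ^ k * Real.exp (-(ν * t / 6)) ≤ Real.exp (-1) := by
    have h2 : (2 : ℝ) ^ k ≤ Real.exp k := by
      rw [← mul_one (k : ℝ), Real.exp_nat_mul]
      exact pow_le_pow_left₀ (by norm_num) (by linarith [Real.exp_one_gt_d9]) k
    have h3 : 12 * (k : ℝ) ≤ ν * t := by
      have h4 : 12 * ((k : ℝ) / ν) ≤ t := by nlinarith [mul_nonneg hk0.le hlog]
      have h5 := mul_le_mul_of_nonneg_left h4 hν.le
      have h6 : ν * (12 * ((k : ℝ) / ν)) = 12 * k := by field_simp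
      linarith
    calc (2 : ℝ) ^ k * Real.exp (-(ν * t / 6)) ≤ Real.exp k * Real.exp (-(ν * t / 6)) := by gcongr
      _ = Real.exp (k + -(ν * t / 6)) := (Real.exp_add _ _).symm
      _ ≤ Real.exp (-1) := Real.exp_le_exp.2 (by linarith)
  have h2 : (k : ℝ) * (2 * Real.exp (-(β * (t / k)))) < 1 / 2 := by
    have h3 : 12 + Real.log (2 * k) ≤ β * (t / k) := by
      have h5 : 12 * ((1 : ℝ) / ν + Real.log (2 * k)) ≤ t / k := by
        rw [le_div_iff₀ hk0]
        refine le_trans (le_of_eq ?_) ht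
        ring
      have h6 : (1 : ℝ) ≤ 1 / ν := by rw [le_div_iff₀ hν]; linarith
      have h7 : (t : ℝ) / k ≤ β * (t / k) := le_mul_of_one_le_left (by positivity) hβ
      linarith
    have h4 : Real.exp (-(β * (t / k))) ≤ Real.exp (-1) * (2 * k : ℝ)⁻¹ := by
      rw [← Real.exp_log (by positivity : (0 : ℝ) < 2 * k), ← Real.exp_neg, ← Real.exp_add]
      exact Real.exp_le_exp.2 (by linarith)
    calc (k : ℝ) * (2 * Real.exp (-(β * (t / k))))
        ≤ k * (2 * (Real.exp (-1) * (2 * k : ℝ)⁻¹)) := by gcongr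
      _ = Real.exp (-1) := by field_simp
      _ < 1 / 2 := he
  linarith

/-- Existence of `(α,δ,ν)`-representative families (Lemma: representative sets exist).
There is an absolute constant `C > 0` such that for every finite universe `U` of size
`k ≥ 1`, all `α, δ, ν ∈ (0,1)`, and `s = ⌈3·ln(4/ν)/(α²·δ)⌉ ≤ k`, there exist
`1 ≤ t ≤ C·(k/ν + k·ln(2k))` and a family `S 1, …, S t` of `s`-element subsets of `U`
such that:
(i) for every `T ⊆ U` with `|T| ≥ δk`, at least `(1−ν)·t` indices `i` satisfy
    `|S i ∩ T|/s ∈ [(1−α)·|T|/k, (1+α)·|T|/k]`;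
(ii) for every `T ⊆ U` with `|T| < δk`, at least `(1−ν)·t` indices `i` satisfy
    `|S i ∩ T|/s ≤ (1+α)·δ`;
(iii) for every `u ∈ U`, the number of indices `i` with `u ∈ S i` lies in
    `[(1−α)·s·t/k, (1+α)·s·t/k]`. -/
theorem representative_sets_exist :
    ∃ C : ℝ, 0 < C ∧
      ∀ (U : Type) [Fintype U] [DecidableEq U] (α δ ν : ℝ),
        0 < α → α < 1 → 0 < δ → δ < 1 → 0 < ν → ν < 1 →
        1 ≤ Fintype.card U →
        repSetSize α δ ν ≤ Fintype.card U →
        ∃ t : ℕ, 1 ≤ t ∧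
          (t : ℝ) ≤ C * ((Fintype.card U : ℝ) / ν +
            (Fintype.card U : ℝ) * Real.log (2 * Fintype.card U)) ∧
          ∃ S : Fin t → Finset U,
            (∀ i, (S i).card = repSetSize α δ ν) ∧
            (∀ T : Finset U, δ * Fintype.card U ≤ (T.card : ℝ) →
              (1 - ν) * t ≤
                (((univ : Finset (Fin t)).filter (fun i =>
                  ((S i ∩ T).card : ℝ) / (repSetSize α δ ν : ℝ) ∈
                    Set.Icc ((1 - α) * T.card / Fintype.card U)
                      ((1 + α) * T.card / Fintype.card U))).card : ℝ)) ∧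
            (∀ T : Finset U, (T.card : ℝ) < δ * Fintype.card U →
              (1 - ν) * t ≤
                (((univ : Finset (Fin t)).filter (fun i =>
                  ((S i ∩ T).card : ℝ) / (repSetSize α δ ν : ℝ) ≤ (1 + α) * δ)).card : ℝ)) ∧
            (∀ u : U,
              ((((univ : Finset (Fin t)).filter (fun i => u ∈ S i)).card : ℝ)) ∈
                Set.Icc ((1 - α) * (repSetSize α δ ν : ℝ) * t / Fintype.card U)
                  ((1 + α) * (repSetSize α δ ν : ℝ) * t / Fintype.card U)) := by
  refine ⟨13, by norm_num, ?_⟩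
  intro U _ _ α δ ν hα hα1 hδ hδ1 hν hν1 hU hsU
  set k := Fintype.card U with hk
  set s := repSetSize α δ ν with hs
  have hk1 : (1 : ℝ) ≤ k := by exact_mod_cast hU
  have hlog4 : 1 ≤ Real.log (4 / ν) := by
    rw [Real.le_log_iff_exp_le (by positivity), le_div_iff₀ hν]
    nlinarith [Real.exp_one_lt_d9, Real.exp_pos 1]
  have hsle : 3 * Real.log (4 / ν) / (α ^ 2 * δ) ≤ s := Nat.le_ceil _
  have hs0 : 0 < s := Nat.ceil_pos.2 (by positivity)
  have hs' : (0 : ℝ) < s := by exact_mod_cast hs0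
  rw [div_le_iff₀ (by positivity)] at hsle
  have hlogk : 0 ≤ Real.log (2 * k) := Real.log_nonneg (by linarith)
  have hkν : 1 ≤ (k : ℝ) / ν := by rw [le_div_iff₀ hν]; linarith
  set R : ℝ := (k : ℝ) / ν + k * Real.log (2 * k) with hR
  have hR1 : 1 ≤ R := by
    have : 0 ≤ (k : ℝ) * Real.log (2 * k) := by positivity
    linarith
  have htle : 12 * R ≤ (⌈12 * R⌉₊ : ℝ) := Nat.le_ceil _
  have htlt : (⌈12 * R⌉₊ : ℝ) < 12 * R + 1 := Nat.ceil_lt_add_one (by linarith)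
  set t := ⌈12 * R⌉₊
  have ht1 : (1 : ℝ) ≤ t := by linarith
  have hβ : 1 ≤ α ^ 2 * s / 3 := by
    have : s * (α ^ 2 * δ) ≤ s * α ^ 2 := by
      have := mul_nonneg hs'.le (sq_nonneg α)
      nlinarith
    linarith
  have hΩ : (powersetCard s (univ : Finset U)).Nonempty :=
    powersetCard_nonempty.2 (by rwa [card_univ])
  obtain ⟨S, hSΩ, hB, hD⟩ := exists_balanced_sequence (α := α) (ν := ν) (p := s / k) (t := t)
    (powersetCard s (univ : Finset U)) hΩ (fun T S => ¬ IsRepresentativeFor α δ s T S)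
    (fun u S => u ∈ S) hα hα1.le hν (by positivity)
    (fun T => by
      convert card_filter_not_isRepresentativeFor_le hα hα1 hδ hν hs0 hU (by linarith) T)
    (fun u => by convert card_filter_mem_powersetCard_univ_div u hs0 hsU)
    (by
      have h := two_pow_mul_exp_add_lt_one hU hν hν1 hβ htle
      rw [Fintype.card_finset]
      have e : α ^ 2 * ((s : ℝ) / k * t) / 3 = α ^ 2 * s / 3 * (t / k) := by ring
      rw [e]
      exact_mod_cast h)
  have hgood : ∀ (T : Finset U) (P : Fin t → Prop) [DecidablePred P],
      (∀ i, IsRepresentativeFor α δ s T (S i) → P i) → (1 - ν) * t ≤ (#{i | P i} : ℝ) := by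
    intro T P _ hP
    classical
    have h1 : (#{i | P i} : ℝ) + #{i | ¬ P i} = t := by
      exact_mod_cast (card_filter_add_card_filter_not (s := univ) P).trans (by simp)
    have h2 : (#{i | ¬ P i} : ℝ) ≤ #{i | ¬ IsRepresentativeFor α δ s T (S i)} := by
      refine Nat.cast_le.2 (card_le_card fun i hi => ?_)
      rw [mem_filter] at hi ⊢
      exact ⟨hi.1, fun h => hi.2 (hP i h)⟩
    have h3 := hB T
    have h4 : (#{i | ¬ IsRepresentativeFor α δ s T (S i)} : ℝ) ≤ ν * t := by convert h3
    linarith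
  refine ⟨t, by exact_mod_cast ht1, by linarith, S, fun i => mem_powersetCard_univ.1 (hSΩ i),
    fun T hT => hgood T _ fun i h => h.1 hT, fun T hT => hgood T _ fun i h => h.2 hT, fun u => ?_⟩
  have h := hD u
  have e : ∀ c : ℝ, c * (s / k * t) = c * s * t / k := fun c => by ring
  rw [e, e] at h
  convert h
end

section
/- Let U be a finite set of size k, let 0 < α < 1, 0 < δ < 1, 0 < ν < 1, and let S_1, …, S_t be subsets of U of common size s ≥ 1 satisfying: (iii) for every u ∈ U, the number of indices i ∈ [t] with u ∈ S_i lies in [(1−α)·s·t/k, (1+α)·s·t/k]. Let ψ ⊆ U with |ψ| ≥ δk, and let E ⊆ [t] be the set of indices i with |S_i ∩ ψ| ∈ [(1−α)·s·|ψ|/k, (1+α)·s·|ψ|/k], and suppose |E| ≥ (1−ν)·t. Consider the experiment of picking an index i uniformly at random from [t] and then, if S_i ∩ ψ ≠ ∅, picking a color c' uniformly at random from S_i ∩ ψ. Then for every c ∈ ψ, the probability that simultaneously i ∈ E and c' = c satisfies: it is at most ((1+α)/(1−α))·(1/|ψ|), and it is at least ((1−α) − ν·k/s)/(1+α) · (1/|ψ|).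 -/
open Finset

/-- Near-uniform sampling of a single palette color via a representative family.
Suppose the `s`-element sets `S 1, …, S t` over a universe `U` of size `k` satisfy the
single-element property (iii): every `u ∈ U` belongs to between `(1−α)·s·t/k` and
`(1+α)·s·t/k` of the sets.  Let `ψ ⊆ U` with `|ψ| ≥ δk`, let `E` be the set of indices `i`
with `|S i ∩ ψ| ∈ [(1−α)·s·|ψ|/k, (1+α)·s·|ψ|/k]`, and suppose `|E| ≥ (1−ν)·t`.
In the experiment of picking `i` uniformly at random from `[t]` and then, if
`S i ∩ ψ ≠ ∅`, picking a color `c'` uniformly at random from `S i ∩ ψ`, the probability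
`p` that simultaneously `i ∈ E` and `c' = c` (for any fixed `c ∈ ψ`) satisfies
`p ≤ ((1+α)/(1−α))·(1/|ψ|)` and `p ≥ (((1−α) − ν·k/s)/(1+α))·(1/|ψ|)`. -/
theorem representative_family_single_color_sampling
    {U : Type*} [Fintype U] [DecidableEq U]
    (α δ ν : ℝ) (hα0 : 0 < α) (hα1 : α < 1) (hδ0 : 0 < δ) (hδ1 : δ < 1)
    (hν0 : 0 < ν) (hν1 : ν < 1)
    (t s : ℕ) (ht : 1 ≤ t) (hs : 1 ≤ s)
    (S : Fin t → Finset U) (hcard : ∀ i, (S i).card = s)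
    (hiii : ∀ u : U,
      ((((univ : Finset (Fin t)).filter (fun i => u ∈ S i)).card : ℝ)) ∈
        Set.Icc ((1 - α) * s * t / Fintype.card U) ((1 + α) * s * t / Fintype.card U))
    (ψ : Finset U) (hψ : δ * Fintype.card U ≤ (ψ.card : ℝ))
    (E : Finset (Fin t))
    (hE : E = (univ : Finset (Fin t)).filter (fun i =>
      (((S i ∩ ψ).card : ℝ)) ∈
        Set.Icc ((1 - α) * s * ψ.card / Fintype.card U)
          ((1 + α) * s * ψ.card / Fintype.card U)))
    (hEcard : (1 - ν) * t ≤ (E.card : ℝ))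
    (c : U) (hc : c ∈ ψ)
    (p : ℝ)
    (hp : p = (1 / t : ℝ) *
      ∑ i : Fin t, if i ∈ E ∧ c ∈ S i ∩ ψ then 1 / (((S i ∩ ψ).card : ℝ)) else 0) :
    p ≤ ((1 + α) / (1 - α)) * (1 / (ψ.card : ℝ)) ∧
      (((1 - α) - ν * Fintype.card U / s) / (1 + α)) * (1 / (ψ.card : ℝ)) ≤ p := by
  have hk : (0 : ℝ) < Fintype.card U := by exact_mod_cast Fintype.card_pos_iff.mpr ⟨c⟩
  have hm : (0 : ℝ) < ψ.card := by exact_mod_cast Finset.card_pos.mpr ⟨c, hc⟩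
  have hs' : (0 : ℝ) < s := by exact_mod_cast hs
  have ht' : (0 : ℝ) < t := by exact_mod_cast ht
  have h1α : 0 < 1 - α := by linarith
  have h2α : 0 < 1 + α := by linarith
  obtain ⟨hlo, hup⟩ := hiii c
  set A : Finset (Fin t) := univ.filter (fun i => c ∈ S i) with hA
  have hsum : (∑ i : Fin t, if i ∈ E ∧ c ∈ S i ∩ ψ then 1 / (((S i ∩ ψ).card : ℝ)) else 0) =
      ∑ i ∈ A ∩ E, 1 / (((S i ∩ ψ).card : ℝ)) := by
    rw [← Finset.sum_filter]
    congr 1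
    ext i
    simp [hA, hc, and_comm]
  rw [hsum] at hp
  have hmem : ∀ i ∈ A ∩ E, (1 - α) * s * ψ.card / Fintype.card U ≤ ((S i ∩ ψ).card : ℝ) ∧
      ((S i ∩ ψ).card : ℝ) ≤ (1 + α) * s * ψ.card / Fintype.card U := by
    intro i hi
    have hiE := (Finset.mem_inter.mp hi).2
    rw [hE] at hiE
    exact (Finset.mem_filter.mp hiE).2
  have hlow_pos : 0 < (1 - α) * s * ψ.card / Fintype.card U := by positivity
  have hupp_pos : 0 < (1 + α) * s * ψ.card / Fintype.card U := by positivity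
  have hcard_le : ((A ∩ E).card : ℝ) ≤ (1 + α) * s * t / Fintype.card U :=
    le_trans (by exact_mod_cast Finset.card_le_card Finset.inter_subset_left) hup
  have hcard_ge : (1 - α) * s * t / Fintype.card U - ν * t ≤ ((A ∩ E).card : ℝ) := by
    have hincl : ((A ∪ E).card : ℝ) + (A ∩ E).card = A.card + E.card := by
      exact_mod_cast Finset.card_union_add_card_inter A E
    have hunion : ((A ∪ E).card : ℝ) ≤ t := by
      exact_mod_cast (Finset.card_le_univ (A ∪ E)).trans_eq (Fintype.card_fin t)
    linarith
  constructor
  · have hterms : ∑ i ∈ A ∩ E, 1 / (((S i ∩ ψ).card : ℝ)) ≤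
        (A ∩ E).card * (1 / ((1 - α) * s * ψ.card / Fintype.card U)) := by
      rw [← nsmul_eq_mul]
      exact Finset.sum_le_card_nsmul _ _ _ fun i hi =>
        one_div_le_one_div_of_le hlow_pos (hmem i hi).1
    calc p ≤ (1 / t : ℝ) * (((1 + α) * s * t / Fintype.card U) *
          (1 / ((1 - α) * s * ψ.card / Fintype.card U))) := by
          rw [hp]
          gcongr
          exact hterms.trans (by gcongr)
      _ = ((1 + α) / (1 - α)) * (1 / (ψ.card : ℝ)) := by field_simp
  · have hterms : (A ∩ E).card * (1 / ((1 + α) * s * ψ.card / Fintype.card U)) ≤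
        ∑ i ∈ A ∩ E, 1 / (((S i ∩ ψ).card : ℝ)) := by
      rw [← nsmul_eq_mul]
      exact Finset.card_nsmul_le_sum _ _ _ fun i hi =>
        one_div_le_one_div_of_le (hlow_pos.trans_le (hmem i hi).1) (hmem i hi).2
    calc (((1 - α) - ν * Fintype.card U / s) / (1 + α)) * (1 / (ψ.card : ℝ))
        = (1 / t : ℝ) * (((1 - α) * s * t / Fintype.card U - ν * t) *
          (1 / ((1 + α) * s * ψ.card / Fintype.card U))) := by field_simp
      _ ≤ p := by
          rw [hp]
          gcongr
          exact le_trans (by gcongr) hterms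
end
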